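/- There exist absolute constants c_1, c_2 > 0 such that for all integers n ≥ 1 and 3 ≤ w ≤ n/10 the following holds. Let Δ(n,w) be the infimum of all reals Δ ≥ 0 such that some length-n width-w ROBP over {0,1} computes ApproxCount[n,Δ]. Then n/2 − c_2·√(nw) ≤ Δ(n,w) ≤ n/2 − c_1·√(nw). -/

import Mathlib

open Finset

/-- A length-`n` read-once branching program over alphabet `σ` with outputs in `Out`.
Layer `t` has vertex set `Fin (size t)` (only layers `0, 1, …, n` are relevant);
layer `0` consists of a single start vertex, and each vertex of layer `t` has an
outgoing edge to layer `t+1` for every letter of the alphabet. -/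
structure ROBP (σ Out : Type) (n : ℕ) where
  size : ℕ → ℕ
  size0 : size 0 = 1
  sizePos : ∀ t, 0 < size t
  step : (t : ℕ) → Fin (size t) → σ → Fin (size (t + 1))
  out : Fin (size n) → Out

namespace ROBP

variable {σ Out : Type} {n : ℕ}

/-- The vertex reached in layer `t` on input `x` (only `x 0, …, x (t-1)` matter). -/
def state (P : ROBP σ Out n) (x : ℕ → σ) : (t : ℕ) → Fin (P.size t)
  | 0 => ⟨0, P.sizePos 0⟩
  | t + 1 => P.step t (state P x t) (x t)

/-- The width of an ROBP: the maximal number of vertices in a single layer. -/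
def width (P : ROBP σ Out n) : ℕ := (Finset.range (n + 1)).sup P.size

/-- Every vertex (in the relevant layers) is reached by some input: no useless vertices. -/
def Reachable (P : ROBP σ Out n) : Prop :=
  ∀ t, t ≤ n → ∀ v : Fin (P.size t), ∃ x : ℕ → σ, P.state x t = v

/-- The output of the program on input `x`. -/
def eval (P : ROBP σ Out n) (x : ℕ → σ) : Out := P.out (P.state x n)

end ROBP

/-- The number of occurrences of `j` among `x 0, …, x (t-1)`. -/
def countK {k : ℕ} (x : ℕ → Fin k) (t : ℕ) (j : Fin k) : ℕ :=
  ((Finset.range t).filter fun i => x i = j).card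

/-- `P` computes `ApproxCount_k[n, Δ]`: on every input, each of the `k` outputs estimates
the frequency of the corresponding letter within additive error `Δ`. -/
def ComputesApproxCountK (k n : ℕ) (Δ : ℝ) (P : ROBP (Fin k) (Fin k → ℝ) n) : Prop :=
  ∀ x : ℕ → Fin k, ∀ j : Fin k, |P.eval x j - (countK x n j : ℝ)| ≤ Δ

/-- `P` computes `ApproxCount[n, Δ]` (the `{0,1}` case). -/
def ComputesApproxCount (n : ℕ) (Δ : ℝ) (P : ROBP Bool ℝ n) : Prop :=
  ∀ x : ℕ → Bool, |P.eval x - (((Finset.range n).filter fun i => x i = true).card : ℝ)| ≤ Δ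

/-- The number of `1`'s in coordinate `j` among `x 0, …, x (t-1)`. -/
def countPar {k : ℕ} (x : ℕ → (Fin k → Bool)) (t : ℕ) (j : Fin k) : ℕ :=
  ((Finset.range t).filter fun i => x i j = true).card

/-- `P` computes `ApproxCount^par_k[n, Δ]`. -/
def ComputesApproxCountPar (k n : ℕ) (Δ : ℝ) (P : ROBP (Fin k → Bool) (Fin k → ℝ) n) : Prop :=
  ∀ x : ℕ → (Fin k → Bool), ∀ j : Fin k, |P.eval x j - (countPar x n j : ℝ)| ≤ Δ

/-- The inclusion `[k-1] ⊆ [k]`. -/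
def idx {k : ℕ} (j : Fin (k - 1)) : Fin k := Fin.castLE (Nat.sub_le k 1) j

/-- `a_j(v)`: the minimal possible number of `j`'s in the first `t` input words
reaching the vertex `v` of layer `t`. -/
noncomputable def rectLo {k n : ℕ} (P : ROBP (Fin k) (Fin k → ℝ) n) (t : ℕ)
    (v : Fin (P.size t)) (j : Fin (k - 1)) : ℕ :=
  sInf {c | ∃ x : ℕ → Fin k, P.state x t = v ∧ countK x t (idx j) = c}

/-- `b_j(v)`: the maximal possible number of `j`'s in the first `t` input words
reaching the vertex `v` of layer `t`. -/
noncomputable def rectHi {k n : ℕ} (P : ROBP (Fin k) (Fin k → ℝ) n) (t : ℕ)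
    (v : Fin (P.size t)) (j : Fin (k - 1)) : ℕ :=
  sSup {c | ∃ x : ℕ → Fin k, P.state x t = v ∧ countK x t (idx j) = c}

/-- `a_j(v)` for the `k`-parallel case. -/
noncomputable def parLo {k n : ℕ} (P : ROBP (Fin k → Bool) (Fin k → ℝ) n) (t : ℕ)
    (v : Fin (P.size t)) (j : Fin k) : ℕ :=
  sInf {c | ∃ x : ℕ → (Fin k → Bool), P.state x t = v ∧ countPar x t j = c}

/-- `b_j(v)` for the `k`-parallel case. -/
noncomputable def parHi {k n : ℕ} (P : ROBP (Fin k → Bool) (Fin k → ℝ) n) (t : ℕ)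
    (v : Fin (P.size t)) (j : Fin k) : ℕ :=
  sSup {c | ∃ x : ℕ → (Fin k → Bool), P.state x t = v ∧ countPar x t j = c}

/-- The axis-parallel box `[lo 1, hi 1] × ⋯ × [lo m, hi m]` (as a set of integer points). -/
def rect {m : ℕ} (lo hi : Fin m → ℕ) : Set (Fin m → ℕ) :=
  {y | ∀ j, lo j ≤ y j ∧ y j ≤ hi j}

/-- The potential `φ_t(x)` of the point `x` (k-counter case): the maximum, over all
rectangle labels of layer `t` containing `x`, of `min{Σ_j b_j, t} - Σ_j x_j`. -/
noncomputable def phiK {k n : ℕ} (P : ROBP (Fin k) (Fin k → ℝ) n) (t : ℕ)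
    (x : Fin (k - 1) → ℕ) : ℕ :=
  Finset.univ.sup fun v : Fin (P.size t) =>
    if ∀ j, rectLo P t v j ≤ x j ∧ x j ≤ rectHi P t v j then
      min (∑ j, rectHi P t v j) t - ∑ j, x j
    else 0

/-- `T_{t,k}`: tuples of naturals summing to at most `t`. -/
def Tset (k t : ℕ) : Finset (Fin (k - 1) → ℕ) :=
  (Fintype.piFinset fun _ => Finset.range (t + 1)).filter fun x => ∑ j, x j ≤ t

/-- The total potential `Φ_t` of layer `t` (k-counter case). -/
noncomputable def PhiK {k n : ℕ} (P : ROBP (Fin k) (Fin k → ℝ) n) (t : ℕ) : ℕ :=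
  ∑ x ∈ Tset k t, phiK P t x

/-- The potential `φ_t(x)` of the point `x` (k-parallel case). -/
noncomputable def phiPar {k n : ℕ} (P : ROBP (Fin k → Bool) (Fin k → ℝ) n) (t : ℕ)
    (x : Fin k → ℕ) : ℕ :=
  Finset.univ.sup fun v : Fin (P.size t) =>
    if ∀ j, parLo P t v j ≤ x j ∧ x j ≤ parHi P t v j then
      (∑ j, parHi P t v j) - ∑ j, x j
    else 0

/-- The total potential `Φ_t` of layer `t` (k-parallel case): the sum of `φ_t(x)`
over `x ∈ {0, 1, …, ⌊n/10⌋}^k`. -/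
noncomputable def PhiPar {k n : ℕ} (P : ROBP (Fin k → Bool) (Fin k → ℝ) n) (t : ℕ) : ℕ :=
  ∑ x ∈ Fintype.piFinset (fun _ : Fin k => Finset.range (n / 10 + 1)), phiPar P t x

/-- The generalized binomial coefficient `C(x, m) = x (x-1) ⋯ (x-m+1) / m!`. -/
noncomputable def genChoose (x : ℝ) (m : ℕ) : ℝ :=
  (∏ i ∈ Finset.range m, (x - (i : ℝ))) / (Nat.factorial m : ℝ)

/-- `Δ(n,w)`: the infimum of all `Δ ≥ 0` such that some length-`n` ROBP over `{0,1}`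
of width at most `w` computes `ApproxCount[n,Δ]`. -/
noncomputable def DeltaOpt (n w : ℕ) : ℝ :=
  sInf {Δ : ℝ | 0 ≤ Δ ∧ ∃ P : ROBP Bool ℝ n, P.Reachable ∧ P.width ≤ w ∧
    ComputesApproxCount n Δ P}

/-- The number of ones among the first `t` bits of `x`. -/
def ones (x : ℕ → Bool) (t : ℕ) : ℕ := ((Finset.range t).filter fun i => x i = true).card

theorem ones_succ (x : ℕ → Bool) (t : ℕ) : ones x (t + 1) = ones x t + (x t).toNat := by
  unfold ones
  rw [Finset.range_add_one, Finset.filter_insert]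
  cases h : x t <;> simp

theorem ones_congr {x y : ℕ → Bool} {t : ℕ} (h : ∀ i < t, x i = y i) : ones x t = ones y t := by
  unfold ones
  congr 1
  apply Finset.filter_congr
  intro i hi
  rw [h i (Finset.mem_range.1 hi)]

theorem ones_le (x : ℕ → Bool) (t : ℕ) : ones x t ≤ t := by
  simpa [ones] using Finset.card_filter_le (Finset.range t) fun i => x i = true

theorem update_eq_of_lt (x : ℕ → Bool) (t : ℕ) (b : Bool) :
    ∀ i < t, Function.update x t b i = x i := fun i hi => by
  simp [hi.ne]

theorem ones_update (x : ℕ → Bool) (t : ℕ) (b : Bool) :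
    ones (Function.update x t b) (t + 1) = ones x t + b.toNat := by
  rw [ones_succ, ones_congr (update_eq_of_lt x t b), Function.update_self]

theorem exists_ones_eq {c t : ℕ} (h : c ≤ t) : ∃ x, ones x t = c := by
  refine ⟨fun i => decide (i < c), ?_⟩
  have : ((Finset.range t).filter fun i => decide (i < c) = true) = Finset.range c := by
    ext i
    simp only [Finset.mem_filter, Finset.mem_range, decide_eq_true_eq]
    omega
  rw [ones, this, Finset.card_range]

theorem two_mul_sum_range_sub (n : ℕ) :
    2 * ∑ x ∈ Finset.range (n + 1), (n - x) = n * (n + 1) := by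
  induction n with
  | zero => simp
  | succ n ih =>
    rw [Finset.sum_range_succ']
    simp only [Nat.add_sub_add_right, Nat.sub_zero]
    rw [mul_add, ih]
    ring

namespace ROBP

section Run

variable {S : Type}

/-- The state reached after `t` steps of the transition system `f` started at `s`. -/
def run (f : ℕ → S → Bool → S) (s : S) (x : ℕ → Bool) : ℕ → S
  | 0 => s
  | t + 1 => f t (run f s x t) (x t)

theorem run_congr (f : ℕ → S → Bool → S) (s : S) {x y : ℕ → Bool} {t : ℕ}
    (h : ∀ i < t, x i = y i) : run f s x t = run f s y t := by
  induction t with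
  | zero => rfl
  | succ t ih =>
    simp only [run]
    rw [ih fun i hi => h i (by omega), h t (by omega)]

/-- Any transition system on at most `w` states yields, after discarding the unreachable
states of each layer, an ROBP of width at most `w`. -/
theorem exists_of_run [Finite S] (f : ℕ → S → Bool → S) (s : S) (g : S → ℝ) (n w : ℕ)
    (hw : Nat.card S ≤ w) :
    ∃ P : ROBP Bool ℝ n, P.Reachable ∧ P.width ≤ w ∧ ∀ x, P.eval x = g (run f s x n) := by
  let R : ℕ → Type := fun t => {a : S // ∃ x, run f s x t = a}
  let e : ∀ t, R t ≃ Fin (Nat.card (R t)) := fun t => Finite.equivFin (R t)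
  have hstep : ∀ t (v : R t) (b : Bool), ∃ x, run f s x (t + 1) = f t v.1 b := by
    rintro t ⟨_, x, rfl⟩ b
    refine ⟨Function.update x t b, ?_⟩
    simp only [run]
    rw [run_congr f s (update_eq_of_lt x t b), Function.update_self]
  let P : ROBP Bool ℝ n :=
    { size := fun t => Nat.card (R t)
      size0 := by
        rw [Nat.card_eq_one_iff_unique]
        refine ⟨⟨?_⟩, ⟨⟨s, fun _ => true, rfl⟩⟩⟩
        rintro ⟨_, x, rfl⟩ ⟨_, y, rfl⟩
        rfl
      sizePos := fun t => by
        have : Nonempty (R t) := ⟨⟨_, fun _ => true, rfl⟩⟩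
        exact Nat.card_pos
      step := fun t v b => e (t + 1) ⟨f t ((e t).symm v).1 b, hstep t _ b⟩
      out := fun v => g ((e n).symm v).1 }
  have hstate : ∀ x t, P.state x t = e t ⟨run f s x t, x, rfl⟩ := by
    intro x t
    induction t with
    | zero =>
      apply Fin.ext
      have h1 := (P.state x 0).isLt
      have h2 := (e 0 ⟨run f s x 0, x, rfl⟩).isLt
      have h0 : Nat.card (R 0) = 1 := P.size0
      change (P.state x 0).1 < Nat.card (R 0) at h1
      omega
    | succ t ih =>
      change P.step t (P.state x t) (x t) = _
      rw [ih]
      simp only [P, Equiv.symm_apply_apply, run]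
  refine ⟨P, ?_, ?_, ?_⟩
  · intro t _ v
    obtain ⟨x, hx⟩ := ((e t).symm v).2
    refine ⟨x, ?_⟩
    rw [hstate, ← (e t).apply_symm_apply v]
    congr 1
    exact Subtype.ext hx
  · refine Finset.sup_le fun t _ => le_trans ?_ hw
    exact Finite.card_subtype_le _
  · intro x
    change g ((e n).symm (P.state x n)).1 = _
    rw [hstate, Equiv.symm_apply_apply]

end Run

/-- The transition at time `t` of the block counter: within each block of `R` inputs it counts
ones up to the threshold `m`; a block with fewer than `m` ones sends it to the absorbing
state `none`. -/
def blockStep (R m t : ℕ) : Option (Fin (m + 1)) → Bool → Option (Fin (m + 1))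
  | none, _ => none
  | some i, b =>
    if R ∣ t + 1 then (if m ≤ i + b.toNat then some 0 else none)
    else some ⟨min (i + b.toNat) m, by omega⟩

/-- What the state of the block counter after `t` steps says about the number `c` of ones. -/
def BlockInv (R m t c : ℕ) : Option (Fin (m + 1)) → Prop
  | none => c + R + 1 ≤ t + m
  | some i => m * (t / R) + i ≤ c ∧ (i.1 < m → c + t % R ≤ t + i)

theorem blockInv_run (R m : ℕ) (x : ℕ → Bool) (t : ℕ) :
    BlockInv R m t (ones x t) (run (blockStep R m) (some 0) x t) := by
  induction t with
  | zero => simp [BlockInv, run, ones]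
  | succ t ih =>
    have hle := ones_le x t
    have hb : (x t).toNat ≤ 1 := Bool.toNat_le _
    simp only [run, ones_succ]
    cases hs : run (blockStep R m) (some 0) x t with
    | none =>
      rw [hs] at ih
      simp only [BlockInv, blockStep] at ih ⊢
      omega
    | some i =>
      rw [hs] at ih
      simp only [BlockInv] at ih
      obtain ⟨h1, h2⟩ := ih
      have hi := i.isLt
      by_cases hd : R ∣ t + 1
      · have hdiv : (t + 1) / R = t / R + 1 := by rw [Nat.succ_div, if_pos hd]
        have hmod : (t + 1) % R = 0 := Nat.mod_eq_zero_of_dvd hd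
        have hm1 := Nat.div_add_mod t R
        have hm2 := Nat.div_add_mod (t + 1) R
        rw [hdiv, hmod, mul_add] at hm2
        by_cases hm : m ≤ i + (x t).toNat
        · simp only [blockStep, if_pos hd, if_pos hm, BlockInv, hdiv, hmod, mul_add]
          simp only [Fin.val_zero]
          omega
        · simp only [blockStep, if_pos hd, if_neg hm, BlockInv]
          have := h2 (by omega)
          omega
      · have hdiv : (t + 1) / R = t / R := by rw [Nat.succ_div, if_neg hd, add_zero]
        have hm1 := Nat.div_add_mod t R
        have hm2 := Nat.div_add_mod (t + 1) R
        rw [hdiv] at hm2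
        simp only [blockStep, if_neg hd, BlockInv, hdiv]
        constructor
        · omega
        · intro h
          have := h2 (by omega)
          omega

theorem exists_computesApproxCount (n w : ℕ) (hw : 3 ≤ w) (hn : 10 * w ≤ n) :
    ∃ P : ROBP Bool ℝ n, P.Reachable ∧ P.width ≤ w ∧
      ComputesApproxCount n ((n : ℝ) / 2 - 1 / 9 * Real.sqrt ((n : ℝ) * (w : ℝ))) P := by
  obtain ⟨m, rfl⟩ : ∃ m, w = m + 2 := ⟨w - 2, by omega⟩
  set R := Nat.sqrt (n * (m + 2)) with hRdef
  have hR3 : 3 * (m + 2) ≤ R := by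
    rw [hRdef, Nat.le_sqrt]
    nlinarith
  have hRn : 3 * R ≤ n := by
    have h : R * R ≤ n * (m + 2) := Nat.sqrt_le _
    by_contra hc
    nlinarith
  have hR0 : 0 < R := by omega
  set K := n / R with hK
  have hKR : 2 * n ≤ 3 * (K * R) := by
    have h1 := Nat.div_add_mod n R
    have h2 := Nat.mod_lt n hR0
    rw [mul_comm R, ← hK] at h1
    omega
  set r := Real.sqrt ((n : ℝ) * ((m + 2 : ℕ) : ℝ)) with hr
  have hr0 : 0 ≤ r := Real.sqrt_nonneg _
  have hrr : r * r = (n : ℝ) * ((m + 2 : ℕ) : ℝ) := Real.mul_self_sqrt (by positivity)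
  have hRr : (R : ℝ) ≤ r := by
    apply Real.le_sqrt_of_sq_le
    have : R * R ≤ n * (m + 2) := Nat.sqrt_le _
    rw [sq]
    exact_mod_cast this
  have hrR : r ≤ R + 1 := by
    apply Real.sqrt_le_iff.2 ⟨by positivity, ?_⟩
    have : n * (m + 2) < (R + 1) * (R + 1) := Nat.lt_succ_sqrt _
    rw [sq]
    exact_mod_cast this.le
  have hm : 1 ≤ m := by omega
  have hKm : 2 / 9 * r ≤ (m * K : ℕ) := by
    have h : 2 * (n * (m + 2)) ≤ 9 * (m * K * R) := by nlinarith
    have h' : 2 * (r * r) ≤ 9 * (((m * K : ℕ) : ℝ) * R) := by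
      rw [hrr]
      exact_mod_cast h
    have hRpos : (0 : ℝ) < R := by exact_mod_cast hR0
    by_contra hc
    push Not at hc
    nlinarith
  have hRm : 2 / 9 * r + m ≤ R + 1 := by
    have : (3 * ((m : ℝ) + 2)) ≤ R := by exact_mod_cast hR3
    linarith
  obtain ⟨P, hP, hPw, hPe⟩ := exists_of_run (blockStep R m) (some 0)
    (fun a => a.elim (((n : ℝ) + m - R - 1) / 2) fun _ => ((n : ℝ) + (m * K : ℕ)) / 2) n (m + 2)
    (by simp)
  refine ⟨P, hP, hPw, fun x => ?_⟩
  change |P.eval x - (ones x n : ℝ)| ≤ _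
  have hinv := blockInv_run R m x n
  have hle : (ones x n : ℝ) ≤ n := by exact_mod_cast ones_le x n
  rw [hPe, abs_le]
  cases hs : run (blockStep R m) (some 0) x n with
  | none =>
    rw [hs] at hinv
    have h : (ones x n : ℝ) + R + 1 ≤ n + m := by exact_mod_cast hinv
    have h0 : (0 : ℝ) ≤ ones x n := by positivity
    simp only [Option.elim]
    constructor <;> linarith
  | some i =>
    rw [hs] at hinv
    have h : ((m * K : ℕ) : ℝ) ≤ ones x n := by
      have h' : m * K + i.1 ≤ ones x n := hinv.1
      exact_mod_cast (by omega : m * K ≤ ones x n)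
    simp only [Option.elim]
    constructor <;> linarith

variable {n : ℕ} (P : ROBP Bool ℝ n)

theorem state_congr {x y : ℕ → Bool} {t : ℕ} (h : ∀ i < t, x i = y i) :
    P.state x t = P.state y t := by
  induction t with
  | zero => rfl
  | succ t ih =>
    simp only [state]
    rw [ih fun i hi => h i (by omega), h t (by omega)]

theorem state_update (x : ℕ → Bool) (t : ℕ) (b : Bool) :
    P.state (Function.update x t b) (t + 1) = P.step t (P.state x t) b := by
  simp only [state]
  rw [P.state_congr (update_eq_of_lt x t b), Function.update_self]

/-- Some vertex of layer `t` is reached both with at most `c` ones and with exactly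
`c + d` ones. -/
def Spans (t c d : ℕ) : Prop :=
  ∃ y z, P.state y t = P.state z t ∧ ones y t ≤ c ∧ ones z t = c + d

variable {P}

theorem Spans.add_le {t c d : ℕ} (h : P.Spans t c d) : c + d ≤ t := by
  obtain ⟨_, z, _, _, hz⟩ := h
  exact hz ▸ ones_le z t

theorem spans_zero {t c : ℕ} (h : c ≤ t) : P.Spans t c 0 := by
  obtain ⟨x, hx⟩ := exists_ones_eq h
  exact ⟨x, x, rfl, hx.le, hx⟩

theorem Spans.step {t c d : ℕ} (h : P.Spans t c d) (b : Bool) :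
    P.Spans (t + 1) (c + b.toNat) d := by
  obtain ⟨y, z, hs, hy, hz⟩ := h
  refine ⟨Function.update y t b, Function.update z t b, ?_, ?_, ?_⟩
  · rw [state_update, state_update, hs]
  · rw [ones_update]
    omega
  · rw [ones_update]
    omega

variable (P)

open Classical in
/-- The potential of `c` in layer `t`: the largest `d` with `P.Spans t c d`. -/
noncomputable def potential (t c : ℕ) : ℕ := Nat.findGreatest (P.Spans t c) t

variable {P}

theorem spans_potential {t c : ℕ} (h : c ≤ t) : P.Spans t c (P.potential t c) := by
  classical
  exact Nat.findGreatest_spec (P := P.Spans t c) (Nat.zero_le t) (spans_zero h)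

theorem Spans.le_potential {t c d : ℕ} (h : P.Spans t c d) : d ≤ P.potential t c := by
  classical
  exact Nat.le_findGreatest (by have := h.add_le; omega) h

theorem card_nondescents_le (t : ℕ) :
    ((Finset.range t).filter fun c => P.potential t c ≤ P.potential t (c + 1)).card
      ≤ P.size t := by
  have key : ∀ c ∈ (Finset.range t).filter fun c => P.potential t c ≤ P.potential t (c + 1),
      ∃ v : Fin (P.size t), (∃ y, P.state y t = v ∧ ones y t ≤ c + 1) ∧
        ∀ y, P.state y t = v → c < ones y t := by
    intro c hc
    rw [Finset.mem_filter, Finset.mem_range] at hc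
    obtain ⟨y, z, hs, hy, hz⟩ := spans_potential (P := P) (t := t) (c := c + 1) hc.1
    refine ⟨P.state z t, ⟨y, hs, hy⟩, fun y' hy' => ?_⟩
    by_contra hlt
    have hsp : P.Spans t c (P.potential t (c + 1) + 1) :=
      ⟨y', z, hy', by omega, by omega⟩
    have := hsp.le_potential
    omega
  have : Nonempty (Fin (P.size t)) := ⟨⟨0, P.sizePos t⟩⟩
  choose! v hv hv' using key
  have hinj := Finset.card_le_card_of_injOn (t := Finset.univ) v (fun _ _ => Finset.mem_univ _)
    (fun a ha b hb hab => by
      obtain ⟨y, hy, hya⟩ := hv a ha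
      obtain ⟨z, hz, hzb⟩ := hv b hb
      have h1 := hv' b hb y (hy.trans hab)
      have h2 := hv' a ha z (hz.trans hab.symm)
      omega)
  simpa using hinj

theorem sum_potential_succ (t : ℕ) :
    ∑ c ∈ Finset.range (t + 1), P.potential t c + t
      ≤ ∑ c ∈ Finset.range (t + 1 + 1), P.potential (t + 1) c + P.size t := by
  have hmono : ∀ c, c ≤ t → P.potential t c ≤ P.potential (t + 1) c := fun c hc =>
    ((spans_potential hc).step false).le_potential
  have hpt : ∀ c ∈ Finset.range t, P.potential t (c + 1) + 1 ≤ P.potential (t + 1) (c + 1) +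
      if P.potential t c ≤ P.potential t (c + 1) then 1 else 0 := by
    intro c hc
    rw [Finset.mem_range] at hc
    have h1 := hmono (c + 1) hc
    have h2 : P.potential t c ≤ P.potential (t + 1) (c + 1) :=
      ((spans_potential hc.le).step true).le_potential
    split_ifs <;> omega
  have hsum := Finset.sum_le_sum hpt
  rw [Finset.sum_add_distrib, Finset.sum_add_distrib, ← Finset.card_filter] at hsum
  simp only [Finset.sum_const, Finset.card_range, smul_eq_mul, mul_one] at hsum
  have h0 := hmono 0 (Nat.zero_le t)
  have hcard := card_nondescents_le (P := P) t
  rw [Finset.sum_range_succ', Finset.sum_range_succ _ (t + 1), Finset.sum_range_succ' _ t]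
  omega

theorem sq_le_sum_potential {w t : ℕ} (hw : P.width ≤ w) (ht : t ≤ n) :
    t * t ≤ 2 * ∑ c ∈ Finset.range (t + 1), P.potential t c + 2 * (t * w) + t := by
  induction t with
  | zero => simp
  | succ t ih =>
    have h1 := ih (by omega)
    have h2 := sum_potential_succ (P := P) t
    have h3 : P.size t ≤ w := le_trans
      (Finset.le_sup (f := P.size) (Finset.mem_range.2 (by omega))) hw
    have h4 : (t + 1) * w = t * w + w := by ring
    have h5 : (t + 1) * (t + 1) = t * t + 2 * t + 1 := by ring
    rw [h4, h5]
    omega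

theorem le_of_computesApproxCount {w : ℕ} {Δ : ℝ} (hw1 : 1 ≤ w) (hΔ : 0 ≤ Δ)
    (hw : P.width ≤ w) (hP : ComputesApproxCount n Δ P) :
    (n : ℝ) / 2 - Real.sqrt ((n : ℝ) * (w : ℝ)) ≤ Δ := by
  have hpot : ∀ c, c ≤ n → P.potential n c ≤ ⌊2 * Δ⌋₊ := by
    intro c hc
    obtain ⟨y, z, hs, hy, hz⟩ := spans_potential (P := P) hc
    apply Nat.le_floor
    have h1 : |P.eval y - (ones y n : ℝ)| ≤ Δ := hP y
    have h2 : |P.eval z - (ones z n : ℝ)| ≤ Δ := hP z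
    have h3 : P.eval y = P.eval z := congrArg P.out hs
    rw [hz] at h2
    rw [h3] at h1
    rw [abs_le] at h1 h2
    have hy' : (ones y n : ℝ) ≤ c := by exact_mod_cast hy
    push_cast at h2
    linarith [h1.1, h1.2, h2.1, h2.2]
  have hfloor : (⌊2 * Δ⌋₊ : ℝ) ≤ 2 * Δ := Nat.floor_le (by linarith)
  set m := ⌊2 * Δ⌋₊
  have hr0 := Real.sqrt_nonneg ((n : ℝ) * (w : ℝ))
  rcases le_total n m with hnm | hmn
  · have : (n : ℝ) ≤ m := by exact_mod_cast hnm
    linarith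
  obtain ⟨D, hD⟩ := Nat.exists_eq_add_of_le hmn
  have hsum : ∑ c ∈ Finset.range (n + 1), P.potential n c + ∑ c ∈ Finset.range (n + 1), (D - c)
      ≤ ∑ c ∈ Finset.range (n + 1), (n - c) := by
    rw [← Finset.sum_add_distrib]
    refine Finset.sum_le_sum fun c hc => ?_
    rw [Finset.mem_range] at hc
    have h1 := hpot c (by omega)
    have h2 := (spans_potential (P := P) (t := n) (c := c) (by omega)).add_le
    omega
  have hsub : ∑ c ∈ Finset.range (D + 1), (D - c) ≤ ∑ c ∈ Finset.range (n + 1), (D - c) :=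
    Finset.sum_le_sum_of_subset (Finset.range_mono (by omega))
  have hDs := two_mul_sum_range_sub D
  have hns := two_mul_sum_range_sub n
  have hlow := sq_le_sum_potential hw (le_refl n)
  have hDD : D * D ≤ 4 * (n * w) := by nlinarith
  have hDr : (D : ℝ) / 2 ≤ Real.sqrt ((n : ℝ) * (w : ℝ)) := by
    apply Real.le_sqrt_of_sq_le
    have : (D : ℝ) * D ≤ 4 * ((n : ℝ) * w) := by exact_mod_cast hDD
    nlinarith
  have hDm : (n : ℝ) = m + D := by exact_mod_cast hD
  linarith

end ROBP

/-- there are absolute constants `c₁, c₂ > 0` such that for all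
`n ≥ 1` and `3 ≤ w ≤ n/10`,
`n/2 - c₂·√(nw) ≤ Δ(n,w) ≤ n/2 - c₁·√(nw)`. -/
theorem stmt16 :
    ∃ c₁ c₂ : ℝ, 0 < c₁ ∧ 0 < c₂ ∧
      ∀ n w : ℕ, 1 ≤ n → 3 ≤ w → 10 * w ≤ n →
        (n : ℝ) / 2 - c₂ * Real.sqrt ((n : ℝ) * (w : ℝ)) ≤ DeltaOpt n w ∧
        DeltaOpt n w ≤ (n : ℝ) / 2 - c₁ * Real.sqrt ((n : ℝ) * (w : ℝ)) := by
  refine ⟨1 / 9, 1, by norm_num, one_pos, fun n w _ hw hn => ?_⟩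
  obtain ⟨P, hreach, hwidth, hcomp⟩ := ROBP.exists_computesApproxCount n w hw hn
  have hmem : (n : ℝ) / 2 - 1 / 9 * Real.sqrt ((n : ℝ) * (w : ℝ)) ∈ {Δ : ℝ | 0 ≤ Δ ∧
      ∃ P : ROBP Bool ℝ n, P.Reachable ∧ P.width ≤ w ∧ ComputesApproxCount n Δ P} :=
    ⟨(abs_nonneg _).trans (hcomp fun _ => true), P, hreach, hwidth, hcomp⟩
  constructor
  · refine le_csInf ⟨_, hmem⟩ ?_
    rintro Δ ⟨hΔ, Q, -, hQw, hQ⟩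
    rw [one_mul]
    exact ROBP.le_of_computesApproxCount (by omega) hΔ hQw hQ
  · exact csInf_le ⟨0, fun Δ hΔ => hΔ.1⟩ hmem
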